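/- Let p > 0 and let β > −1 be such that the function x ↦ 𝒟_β^[p](1 : x) is integrable on ℝ². Then for every s > 0 and every x ∈ (−1/2, 1/2]², the periodization identity Σ_{n ∈ ℤ²} 𝒟_β^[p](s : x − n) = D_β^[p](s : x) holds. -/

import Mathlib

open Real MeasureTheory

/-- The `p`-norm of a point of `ℝ²`. -/
noncomputable def pnorm (p : ℝ) (x : ℝ × ℝ) : ℝ := (|x.1| ^ p + |x.2| ^ p) ^ (1 / p)

/-- The generalized Bessel function of order zero `J₀^[p]`. -/
noncomputable def Jzero (p : ℝ) (η : ℝ × ℝ) : ℝ :=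
  (1 / Real.Gamma (1 / p) ^ 2) * (2 / p) ^ 2 *
    ∫ t in (0:ℝ)..1,
      Real.cos (η.1 * t ^ (1 / p)) * Real.cos (η.2 * (1 - t) ^ (1 / p)) *
        t ^ (1 / p - 1) * (1 - t) ^ (1 / p - 1)

/-- The generalized Bessel function of positive order `J_ω^[p]`. -/
noncomputable def Jord (p ω : ℝ) (η : ℝ × ℝ) : ℝ :=
  pnorm p η ^ ω / (p ^ (ω - 1) * Real.Gamma ω) *
    ∫ τ in (0:ℝ)..1, Jzero p (τ * η.1, τ * η.2) * τ * (1 - τ ^ p) ^ (ω - 1)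

/-- `e^{2πiθ}`. -/
noncomputable def e2πi (θ : ℝ) : ℂ := Complex.exp (((2 * Real.pi * θ : ℝ) : ℂ) * Complex.I)

/-- The integral version `𝒟_β^[p](s : x)`. -/
noncomputable def Dcal (p β s : ℝ) (x : ℝ × ℝ) : ℂ :=
  ((1 / Real.Gamma (β + 1) : ℝ) : ℂ) *
    ∫ ξ in {ξ : ℝ × ℝ | pnorm p ξ ^ p < s},
      (((s - pnorm p ξ ^ p) ^ β : ℝ) : ℂ) * e2πi (x.1 * ξ.1 + x.2 * ξ.2)

/-- The lattice sum version `D_β^[p](s : x)`. -/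
noncomputable def Dlat (p β s : ℝ) (x : ℝ × ℝ) : ℂ :=
  ((1 / Real.Gamma (β + 1) : ℝ) : ℂ) *
    ∑' m : ℤ × ℤ,
      if pnorm p ((m.1 : ℝ), (m.2 : ℝ)) ^ p < s then
        (((s - pnorm p ((m.1 : ℝ), (m.2 : ℝ)) ^ p) ^ β : ℝ) : ℂ) *
          e2πi (x.1 * (m.1 : ℝ) + x.2 * (m.2 : ℝ))
      else 0

open scoped FourierTransform ENNReal NNReal SchwartzMap

lemma e2πi_add (a b : ℝ) : e2πi (a + b) = e2πi a * e2πi b := by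
  simp only [e2πi]
  rw [← Complex.exp_add]
  congr 1
  push_cast
  ring

lemma norm_e2πi (a : ℝ) : ‖e2πi a‖ = 1 := Complex.norm_exp_ofReal_mul_I _

@[fun_prop]
lemma continuous_e2πi : Continuous e2πi := by
  unfold e2πi
  fun_prop

/-- The translates of a Schwartz function are absolutely summable, uniformly in the base point. -/
lemma SchwartzMap.exists_tsum_enorm_sub_intCast_le (φ : 𝓢(ℝ, ℂ)) :
    ∃ C : ℝ≥0, ∀ y : ℝ, ∑' n : ℤ, ‖φ (y - n)‖ₑ ≤ C := by
  obtain ⟨A, hA, h0⟩ := φ.decay 0 0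
  obtain ⟨B, hB, h2⟩ := φ.decay 2 0
  simp only [pow_zero, one_mul, norm_iteratedFDeriv_zero] at h0 h2
  let g : ℤ → ℝ := fun n => 3 * (A + B) * (1 / (n : ℝ) ^ 2) + if n = 0 then A else 0
  have hg0 : ∀ n, 0 ≤ g n := fun n => by
    simp only [g]
    split_ifs <;> positivity
  have hs : Summable g :=
    ((Real.summable_one_div_int_pow.mpr one_lt_two).mul_left _).add (hasSum_ite_eq 0 A).summable
  refine ⟨(∑' n, g n).toNNReal, fun y => ?_⟩
  calc ∑' n : ℤ, ‖φ (y - n)‖ₑ = ∑' n : ℤ, ‖φ (Int.fract y - n)‖ₑ := by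
        rw [← (Equiv.addRight ⌊y⌋).tsum_eq]
        refine tsum_congr fun n => ?_
        congr 2
        have := Int.fract_add_floor y
        simp only [Equiv.coe_addRight, Int.cast_add]
        linarith
    _ ≤ ∑' n : ℤ, ENNReal.ofReal (g n) := by
        refine ENNReal.tsum_le_tsum fun n => ?_
        rw [← ofReal_norm]
        refine ENNReal.ofReal_le_ofReal ?_
        set t := Int.fract y
        have ht0 : 0 ≤ t := Int.fract_nonneg y
        have ht1 : t ≤ 1 := (Int.fract_lt_one y).le
        by_cases hn : n = 0
        · simpa [g, hn] using h0 t
        · simp only [g, hn, if_false, add_zero]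
          have hn' : 0 < (n : ℝ) ^ 2 := by positivity
          rw [mul_one_div, le_div_iff₀ hn']
          have h2' := h2 (t - n)
          have h0' := h0 (t - n)
          rw [Real.norm_eq_abs, sq_abs] at h2'
          have h : (n : ℝ) ^ 2 ≤ 3 * (1 + (t - n) ^ 2) := by
            nlinarith [sq_nonneg (2 * t - n)]
          calc ‖φ (t - n)‖ * (n : ℝ) ^ 2 ≤ ‖φ (t - n)‖ * (3 * (1 + (t - n) ^ 2)) := by gcongr
            _ ≤ 3 * (A + B) := by linarith
    _ = _ := by
        rw [← ENNReal.ofReal_tsum_of_nonneg hg0 hs]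
        rfl

/-- A smooth cutoff together with its inverse Fourier transform, for which Poisson summation
holds. -/
lemma exists_cutoff_poisson (R : ℝ) : ∃ (ψ φ : ℝ → ℂ) (S : Finset ℤ),
    Continuous ψ ∧ Integrable ψ ∧ (∀ t, |t| ≤ R → ψ t = 1) ∧ (∀ n : ℤ, n ∉ S → ψ n = 0) ∧
    Continuous φ ∧ (∀ y, φ y = ∫ v, ψ v * e2πi (v * y)) ∧
    (∃ C : ℝ≥0, ∀ y : ℝ, ∑' n : ℤ, ‖φ (y - n)‖ₑ ≤ C) ∧
    ∀ y : ℝ, ∑' n : ℤ, φ (y - n) = ∑ n ∈ S, ψ n * e2πi (n * y) := by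
  let b : ContDiffBump (0 : ℝ) := ⟨|R| + 1, |R| + 2, by positivity, by linarith⟩
  have hsm : ContDiff ℝ ((⊤ : ℕ∞) : WithTop ℕ∞) fun t => ((b t : ℝ) : ℂ) :=
    Complex.ofRealCLM.contDiff.comp b.contDiff
  have hcs : HasCompactSupport fun t => ((b t : ℝ) : ℂ) :=
    b.hasCompactSupport.comp_left (g := fun x : ℝ => (x : ℂ)) Complex.ofReal_zero
  let ψ : 𝓢(ℝ, ℂ) := hcs.toSchwartzMap hsm
  have hψ : ∀ t, ψ t = (b t : ℂ) := fun t => rfl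
  let φ : 𝓢(ℝ, ℂ) := 𝓕⁻ ψ
  have hψ0 : ∀ n : ℤ, n ∉ Finset.Icc (-⌈|R| + 2⌉) ⌈|R| + 2⌉ → ψ n = 0 := by
    intro n hn
    rw [hψ, b.zero_of_le_dist, Complex.ofReal_zero]
    simp only [b, Real.dist_eq, sub_zero]
    by_contra! h
    apply hn
    have h1 := Int.le_ceil (|R| + 2)
    rw [abs_lt] at h
    rw [Finset.mem_Icc]
    constructor
    · have : -(⌈|R| + 2⌉ : ℝ) ≤ n := by linarith
      exact_mod_cast this
    · have : (n : ℝ) ≤ ⌈|R| + 2⌉ := by linarith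
      exact_mod_cast this
  refine ⟨ψ, φ, Finset.Icc (-⌈|R| + 2⌉) ⌈|R| + 2⌉, ψ.continuous, ψ.integrable, ?_, hψ0,
    φ.continuous, ?_, φ.exists_tsum_enorm_sub_intCast_le, ?_⟩
  · intro t ht
    rw [hψ, b.one_of_mem_closedBall, Complex.ofReal_one]
    simp only [b, Metric.mem_closedBall, Real.dist_eq, sub_zero]
    linarith [le_abs_self R]
  · intro y
    simp only [φ, SchwartzMap.fourierInv_coe, Real.fourierInv_eq', smul_eq_mul]
    refine integral_congr_ae (.of_forall fun v => ?_)
    simp only [e2πi, RCLike.inner_apply, conj_trivial]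
    rw [mul_comm]
    congr 5
    ring
  · intro y
    rw [← (Equiv.neg ℤ).tsum_eq]
    have h := φ.tsum_eq_tsum_fourier y
    simp only [φ, FourierTransform.fourier_fourierInv_eq] at h
    simp only [Equiv.neg_apply, Int.cast_neg, sub_neg_eq_add]
    rw [h, tsum_eq_sum fun n hn => by rw [hψ0 n hn, zero_mul]]
    refine Finset.sum_congr rfl fun n _ => ?_
    rw [fourier_coe_apply]
    simp only [e2πi]
    congr 2
    push_cast
    ring

/-- Poisson summation for a compactly supported function `f` which is pointwise the Fourier
transform of an integrable function `G`. -/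
lemma tsum_fourier_sub_eq_tsum {G f : ℝ × ℝ → ℂ} (hG : Integrable G) {R : ℝ}
    (hR : ∀ ξ, f ξ ≠ 0 → |ξ.1| ≤ R ∧ |ξ.2| ≤ R)
    (hf : ∀ ξ : ℝ × ℝ, f ξ = ∫ z : ℝ × ℝ, G z * e2πi (-(z.1 * ξ.1 + z.2 * ξ.2)))
    (x : ℝ × ℝ) :
    ∑' n : ℤ × ℤ, ∫ ξ : ℝ × ℝ, f ξ * e2πi ((x.1 - n.1) * ξ.1 + (x.2 - n.2) * ξ.2) =
      ∑' m : ℤ × ℤ, f (m.1, m.2) * e2πi (x.1 * m.1 + x.2 * m.2) := by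
  obtain ⟨ψ, φ, S, hψc, hψi, hψ1, hψS, hφc, hφ, ⟨C, hC⟩, hφS⟩ := exists_cutoff_poisson R
  have hcut : ∀ ξ, f ξ = ψ ξ.1 * ψ ξ.2 * f ξ := fun ξ => by
    by_cases h : f ξ = 0
    · simp [h]
    · rw [hψ1 _ (hR ξ h).1, hψ1 _ (hR ξ h).2, one_mul, one_mul]
  have hconv : ∀ y : ℝ × ℝ, ∫ ξ : ℝ × ℝ, f ξ * e2πi (y.1 * ξ.1 + y.2 * ξ.2) =
      ∫ z : ℝ × ℝ, G z * (φ (y.1 - z.1) * φ (y.2 - z.2)) := by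
    intro y
    calc ∫ ξ : ℝ × ℝ, f ξ * e2πi (y.1 * ξ.1 + y.2 * ξ.2)
      _ = ∫ ξ : ℝ × ℝ, ∫ z : ℝ × ℝ, (ψ ξ.1 * ψ ξ.2 * G z) *
            e2πi ((y.1 - z.1) * ξ.1 + (y.2 - z.2) * ξ.2) := by
          refine integral_congr_ae (.of_forall fun ξ => ?_)
          dsimp only
          rw [hcut, hf, mul_right_comm, ← integral_const_mul]
          refine integral_congr_ae (.of_forall fun z => ?_)
          dsimp only
          have : (y.1 - z.1) * ξ.1 + (y.2 - z.2) * ξ.2 =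
            (y.1 * ξ.1 + y.2 * ξ.2) + -(z.1 * ξ.1 + z.2 * ξ.2) := by ring
          rw [this, e2πi_add (_ + _) (-_)]
          ring
      _ = ∫ z : ℝ × ℝ, ∫ ξ : ℝ × ℝ, (ψ ξ.1 * ψ ξ.2 * G z) *
            e2πi ((y.1 - z.1) * ξ.1 + (y.2 - z.2) * ξ.2) := by
          refine integral_integral_swap ?_
          refine ((hψi.mul_prod hψi).mul_prod hG).mul_bdd (c := 1)
            (Continuous.aestronglyMeasurable ?_) (.of_forall fun w => (norm_e2πi _).le)
          fun_prop
      _ = _ := by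
          refine integral_congr_ae (.of_forall fun z => ?_)
          dsimp only
          rw [hφ, hφ, ← integral_prod_mul, ← integral_const_mul, ← Measure.volume_eq_prod]
          refine integral_congr_ae (.of_forall fun ξ => ?_)
          dsimp only
          rw [e2πi_add, mul_comm ξ.1, mul_comm ξ.2]
          ring
  have hCtop : ∀ y, ∑' n : ℤ, ‖φ (y - n)‖ₑ ≠ ∞ := fun y =>
    ((hC y).trans_lt ENNReal.coe_lt_top).ne
  have hsum : ∀ y, Summable fun n : ℤ => ‖φ (y - n)‖ := fun y => by
    have := ENNReal.summable_toReal (hCtop y)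
    simpa using this
  calc ∑' n : ℤ × ℤ, ∫ ξ : ℝ × ℝ, f ξ * e2πi ((x.1 - n.1) * ξ.1 + (x.2 - n.2) * ξ.2)
    _ = ∑' n : ℤ × ℤ, ∫ z : ℝ × ℝ, G z * (φ (x.1 - n.1 - z.1) * φ (x.2 - n.2 - z.2)) :=
        tsum_congr fun n => hconv (x.1 - n.1, x.2 - n.2)
    _ = ∫ z : ℝ × ℝ, ∑' n : ℤ × ℤ, G z * (φ (x.1 - n.1 - z.1) * φ (x.2 - n.2 - z.2)) := by
        have hm : ∀ n : ℤ × ℤ, AEStronglyMeasurable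
            (fun z : ℝ × ℝ => G z * (φ (x.1 - n.1 - z.1) * φ (x.2 - n.2 - z.2))) := fun n =>
          hG.aestronglyMeasurable.mul (Continuous.aestronglyMeasurable (by fun_prop))
        refine (integral_tsum hm ?_).symm
        rw [← lintegral_tsum fun n => (hm n).enorm]
        refine ne_top_of_le_ne_top (b := ∫⁻ z, ‖G z‖ₑ * (C * C)) ?_ (lintegral_mono fun z => ?_)
        · rw [lintegral_mul_const' _ _ (by finiteness)]
          exact ENNReal.mul_ne_top hG.2.ne (by finiteness)
        · simp only [enorm_mul]
          rw [ENNReal.tsum_mul_left]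
          refine mul_le_mul_right ?_ _
          rw [ENNReal.tsum_prod (f := fun a b : ℤ => ‖φ (x.1 - a - z.1)‖ₑ * ‖φ (x.2 - b - z.2)‖ₑ)]
          simp only [ENNReal.tsum_mul_left, ENNReal.tsum_mul_right]
          refine mul_le_mul' ?_ ?_
          · simpa only [sub_right_comm] using hC (x.1 - z.1)
          · simpa only [sub_right_comm] using hC (x.2 - z.2)
    _ = ∫ z : ℝ × ℝ, ∑ m ∈ S ×ˢ S, ψ m.1 * ψ m.2 * e2πi (x.1 * m.1 + x.2 * m.2) *
          (G z * e2πi (-(z.1 * m.1 + z.2 * m.2))) := by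
        refine integral_congr_ae (.of_forall fun z => ?_)
        dsimp only
        simp only [sub_right_comm _ _ z.1, sub_right_comm _ _ z.2]
        rw [tsum_mul_left, ← tsum_mul_tsum_of_summable_norm (hsum _) (hsum _), hφS, hφS,
          Finset.sum_mul_sum, ← Finset.sum_product', Finset.mul_sum]
        refine Finset.sum_congr rfl fun m _ => ?_
        have h1 : (m.1 : ℝ) * (x.1 - z.1) = x.1 * m.1 + -(z.1 * m.1) := by ring
        have h2 : (m.2 : ℝ) * (x.2 - z.2) = x.2 * m.2 + -(z.2 * m.2) := by ring
        rw [h1, h2, neg_add]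
        simp only [e2πi_add]
        ring
    _ = ∑ m ∈ S ×ˢ S, f (m.1, m.2) * e2πi (x.1 * m.1 + x.2 * m.2) := by
        rw [integral_finsetSum]
        · refine Finset.sum_congr rfl fun m _ => ?_
          rw [integral_const_mul, ← hf (m.1, m.2), hcut (m.1, m.2)]
          have := hcut (m.1, m.2)
          dsimp only at this ⊢
          rw [← this]
          conv_rhs => rw [this]
          ring
        · intro m _
          refine (hG.mul_bdd (c := 1) (Continuous.aestronglyMeasurable ?_)
            (.of_forall fun w => (norm_e2πi _).le)).const_mul _
          fun_prop
    _ = _ := by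
        refine (tsum_eq_sum fun m hm => ?_).symm
        rw [hcut (m.1, m.2)]
        rw [Finset.mem_product, not_and_or] at hm
        rcases hm with h | h <;> simp [hψS _ h]

/-- Fourier inversion on `ℝ × ℝ`, at a point of continuity. -/
lemma integral_fourier_mul_e2πi_neg {f : ℝ × ℝ → ℂ} (hf : Integrable f)
    (hD : Integrable fun x : ℝ × ℝ => ∫ ξ : ℝ × ℝ, f ξ * e2πi (x.1 * ξ.1 + x.2 * ξ.2))
    {η : ℝ × ℝ} (hη : ContinuousAt f η) :
    ∫ z : ℝ × ℝ, (∫ ξ : ℝ × ℝ, f ξ * e2πi (z.1 * ξ.1 + z.2 * ξ.2)) *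
      e2πi (-(z.1 * η.1 + z.2 * η.2)) = f η := by
  have hmp : MeasurePreserving (WithLp.ofLp : WithLp 2 (ℝ × ℝ) → ℝ × ℝ) :=
    WithLp.volume_preserving_ofLp ℝ ℝ
  have hemb : MeasurableEmbedding (WithLp.ofLp : WithLp 2 (ℝ × ℝ) → ℝ × ℝ) :=
    (WithLp.homeomorphProd 2 ℝ ℝ).measurableEmbedding
  have hinv : 𝓕⁻ (f ∘ WithLp.ofLp : WithLp 2 (ℝ × ℝ) → ℂ) =
      (fun x : ℝ × ℝ => ∫ ξ : ℝ × ℝ, f ξ * e2πi (x.1 * ξ.1 + x.2 * ξ.2)) ∘ WithLp.ofLp := by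
    ext x
    rw [Real.fourierInv_eq', Function.comp_apply, ← hmp.integral_comp hemb]
    refine integral_congr_ae (.of_forall fun ξ => ?_)
    simp [e2πi, mul_comm]
  have hFi : Integrable (𝓕 (f ∘ WithLp.ofLp : WithLp 2 (ℝ × ℝ) → ℂ)) := by
    have h := ((hmp.integrable_comp_emb hemb).mpr hD).comp_neg
    rw [← hinv] at h
    simpa only [Real.fourierInv_eq_fourier_neg, neg_neg] using h
  have key := MeasureTheory.Integrable.fourier_fourierInv_eq
    (f := (f ∘ WithLp.ofLp : WithLp 2 (ℝ × ℝ) → ℂ)) ((hmp.integrable_comp_emb hemb).mpr hf)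
    hFi (v := WithLp.toLp 2 η)
    (ContinuousAt.comp (by exact hη) (WithLp.prod_continuous_ofLp 2 ℝ ℝ).continuousAt)
  rw [hinv, Real.fourier_eq'] at key
  rw [Function.comp_apply, WithLp.ofLp_toLp] at key
  rw [← key, ← hmp.integral_comp hemb]
  refine integral_congr_ae (.of_forall fun z => ?_)
  simp only [Function.comp_apply, smul_eq_mul, WithLp.prod_inner_apply, RCLike.inner_apply,
    conj_trivial]
  rw [mul_comm]
  congr 1
  simp only [e2πi]
  congr 3
  ring

lemma continuous_integral_mul_e2πi_neg {G : ℝ × ℝ → ℂ} (hG : Integrable G) :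
    Continuous fun η : ℝ × ℝ => ∫ z : ℝ × ℝ, G z * e2πi (-(z.1 * η.1 + z.2 * η.2)) := by
  refine continuous_of_dominated (bound := fun z => ‖G z‖) (fun η => ?_) (fun η => ?_) hG.norm ?_
  · exact hG.aestronglyMeasurable.mul (Continuous.aestronglyMeasurable (by fun_prop))
  · exact .of_forall fun z => by rw [norm_mul, norm_e2πi, mul_one]
  · exact .of_forall fun z => by fun_prop

/-- The `p`-th power of the `p`-norm. -/
noncomputable def powSum (p : ℝ) (ξ : ℝ × ℝ) : ℝ := |ξ.1| ^ p + |ξ.2| ^ p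

/-- The truncated power `(s - |ξ|_p^p)_+ ^ β`, set to zero off the open ball. -/
noncomputable def truncPow (p β s : ℝ) (ξ : ℝ × ℝ) : ℝ :=
  if powSum p ξ < s then (s - powSum p ξ) ^ β else 0

lemma powSum_nonneg (p : ℝ) (ξ : ℝ × ℝ) : 0 ≤ powSum p ξ := by
  unfold powSum
  positivity

lemma pnorm_rpow {p : ℝ} (hp : 0 < p) (ξ : ℝ × ℝ) : pnorm p ξ ^ p = powSum p ξ := by
  have h : 0 ≤ |ξ.1| ^ p + |ξ.2| ^ p := powSum_nonneg p ξ
  rw [pnorm, ← Real.rpow_mul h, one_div_mul_cancel hp.ne', Real.rpow_one, powSum]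

lemma continuous_powSum {p : ℝ} (hp : 0 < p) : Continuous (powSum p) := by
  unfold powSum
  exact (continuous_fst.abs.rpow_const fun _ => .inr hp.le).add
    (continuous_snd.abs.rpow_const fun _ => .inr hp.le)

lemma powSum_smul (p : ℝ) {r : ℝ} (hr : 0 ≤ r) (ξ : ℝ × ℝ) :
    powSum p (r • ξ) = r ^ p * powSum p ξ := by
  simp only [powSum, Prod.smul_fst, Prod.smul_snd, smul_eq_mul, abs_mul, abs_of_nonneg hr]
  rw [Real.mul_rpow hr (abs_nonneg _), Real.mul_rpow hr (abs_nonneg _), mul_add]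

lemma truncPow_nonneg (p β s : ℝ) (ξ : ℝ × ℝ) : 0 ≤ truncPow p β s ξ := by
  unfold truncPow
  split_ifs with h
  · exact Real.rpow_nonneg (by linarith) _
  · exact le_rfl

lemma truncPow_smul (p β s : ℝ) {r : ℝ} (hr : 0 < r) (ξ : ℝ × ℝ) :
    truncPow p β (r ^ p * s) (r • ξ) = (r ^ p) ^ β * truncPow p β s ξ := by
  have hrp : 0 < r ^ p := Real.rpow_pos_of_pos hr p
  simp only [truncPow, powSum_smul p hr.le, mul_lt_mul_iff_right₀ hrp, mul_ite, mul_zero]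
  split_ifs with h
  · rw [← mul_sub, Real.mul_rpow hrp.le (by linarith)]
  · rfl

lemma measurable_truncPow_uncurry {p : ℝ} (hp : 0 < p) (β : ℝ) :
    Measurable fun w : ℝ × (ℝ × ℝ) => truncPow p β w.1 w.2 := by
  have h : Measurable fun w : ℝ × (ℝ × ℝ) => powSum p w.2 :=
    (continuous_powSum hp).measurable.comp measurable_snd
  exact Measurable.ite (measurableSet_lt h measurable_fst)
    ((measurable_fst.sub h).pow_const β) measurable_const

lemma measurable_truncPow {p : ℝ} (hp : 0 < p) (β s : ℝ) : Measurable (truncPow p β s) :=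
  (measurable_truncPow_uncurry hp β).comp measurable_prodMk_left

lemma abs_le_of_powSum_lt {p s : ℝ} (hp : 0 < p) {ξ : ℝ × ℝ} (h : powSum p ξ < s) :
    |ξ.1| ≤ s ^ p⁻¹ ∧ |ξ.2| ≤ s ^ p⁻¹ := by
  have h1 : 0 ≤ |ξ.1| ^ p := by positivity
  have h2 : 0 ≤ |ξ.2| ^ p := by positivity
  unfold powSum at h
  exact ⟨(Real.le_rpow_inv_iff_of_pos (abs_nonneg _) (by linarith) hp).mpr (by linarith),
    (Real.le_rpow_inv_iff_of_pos (abs_nonneg _) (by linarith) hp).mpr (by linarith)⟩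

lemma integrable_truncPow_of_nonneg {p β : ℝ} (hp : 0 < p) (hβ : 0 ≤ β) (s : ℝ) :
    Integrable (truncPow p β s) := by
  have hbox : IsCompact (Set.Icc (-(s ^ p⁻¹), -(s ^ p⁻¹)) (s ^ p⁻¹, s ^ p⁻¹)) := isCompact_Icc
  have hb : ∀ ξ, ‖truncPow p β s ξ‖ ≤ |s| ^ β := fun ξ => by
    rw [Real.norm_of_nonneg (truncPow_nonneg p β s ξ)]
    unfold truncPow
    have := powSum_nonneg p ξ
    split_ifs with h
    · exact Real.rpow_le_rpow (by linarith) (by linarith [le_abs_self s]) hβ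
    · positivity
  refine IntegrableOn.integrable_of_forall_notMem_eq_zero (s := Set.Icc (-(s ^ p⁻¹), -(s ^ p⁻¹))
    (s ^ p⁻¹, s ^ p⁻¹)) ?_ fun ξ hξ => ?_
  · exact Measure.integrableOn_of_bounded hbox.measure_lt_top.ne
      (measurable_truncPow hp β s).aestronglyMeasurable (.of_forall hb)
  · rw [truncPow, if_neg]
    contrapose! hξ
    have := abs_le_of_powSum_lt hp hξ
    rw [abs_le, abs_le] at this
    exact ⟨⟨this.1.1, this.2.1⟩, ⟨this.1.2, this.2.2⟩⟩

lemma truncPow_integrableOn_and_integral {p β : ℝ} (hβ : -1 < β) (ξ : ℝ × ℝ) :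
    IntegrableOn (fun s => truncPow p β s ξ) (Set.Ioc 0 2) ∧
      ∫ s in Set.Ioc 0 2, truncPow p β s ξ = (β + 1)⁻¹ * truncPow p (β + 1) 2 ξ := by
  set N := powSum p ξ with hN
  have hN0 : 0 ≤ N := powSum_nonneg p ξ
  have heq : (fun s => truncPow p β s ξ) = (Set.Ioi N).indicator fun s => (s - N) ^ β := by
    ext s
    simp [truncPow, Set.indicator_apply, hN]
  have hset : Set.Ioc 0 2 ∩ Set.Ioi N = Set.Ioc N 2 := by
    ext s
    simp only [Set.mem_inter_iff, Set.mem_Ioc, Set.mem_Ioi]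
    constructor
    · rintro ⟨⟨_, h⟩, h'⟩; exact ⟨h', h⟩
    · rintro ⟨h, h'⟩; exact ⟨⟨by linarith, h'⟩, h⟩
  rw [heq, setIntegral_indicator measurableSet_Ioi, hset]
  unfold IntegrableOn
  rw [integrable_indicator_iff measurableSet_Ioi]
  unfold IntegrableOn
  rw [Measure.restrict_restrict measurableSet_Ioi, Set.inter_comm, hset]
  by_cases h : N < 2
  · constructor
    · have := (intervalIntegral.intervalIntegrable_rpow' (a := 0) (b := 2 - N) hβ).comp_sub_right N
      rw [zero_add, sub_add_cancel, intervalIntegrable_iff_integrableOn_Ioc_of_le h.le] at this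
      exact this
    · rw [← intervalIntegral.integral_of_le h.le,
        intervalIntegral.integral_comp_sub_right (fun u => u ^ β) N, sub_self,
        integral_rpow (.inl hβ), Real.zero_rpow (by linarith), truncPow, if_pos h]
      rw [sub_zero, div_eq_inv_mul]
  · rw [Set.Ioc_eq_empty h, truncPow, if_neg h]
    simp

lemma integrable_truncPow {p β s : ℝ} (hp : 0 < p) (hβ : -1 < β) (hs : 0 < s) :
    Integrable (truncPow p β s) := by
  have hprod : Integrable (fun w : ℝ × (ℝ × ℝ) => truncPow p β w.1 w.2)
      ((volume.restrict (Set.Ioc 0 2)).prod volume) := by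
    rw [integrable_prod_iff' (measurable_truncPow_uncurry hp β).aestronglyMeasurable]
    refine ⟨.of_forall fun ξ => (truncPow_integrableOn_and_integral hβ ξ).1, ?_⟩
    simp only [Real.norm_of_nonneg (truncPow_nonneg _ _ _ _),
      (truncPow_integrableOn_and_integral hβ _).2]
    exact (integrable_truncPow_of_nonneg hp (by linarith) 2).const_mul _
  have : (ae (volume.restrict (Set.Ioc (0 : ℝ) 2))).NeBot := by
    rw [ae_restrict_neBot]
    simp
  obtain ⟨t, ht, hmem⟩ := (hprod.prod_right_ae.and (ae_restrict_mem measurableSet_Ioc)).exists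
  have ht0 : 0 < t := hmem.1
  have hr : 0 < (t / s) ^ p⁻¹ := by positivity
  have hrp : ((t / s) ^ p⁻¹) ^ p * s = t := by
    rw [Real.rpow_inv_rpow (by positivity) hp.ne', div_mul_cancel₀ _ hs.ne']
  have hc : (((t / s) ^ p⁻¹) ^ p) ^ β ≠ 0 := by positivity
  have h : Integrable fun ξ => truncPow p β t (((t / s) ^ p⁻¹) • ξ) := ht.comp_smul hr.ne'
  have h' : Integrable fun ξ => (((t / s) ^ p⁻¹) ^ p) ^ β * truncPow p β s ξ := by
    refine h.congr (.of_forall fun ξ => ?_)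
    dsimp only
    rw [← truncPow_smul p β s hr, hrp]
  exact (integrable_const_mul_iff (IsUnit.mk0 _ hc) _).mp h'

lemma Dcal_eq {p : ℝ} (hp : 0 < p) (β s : ℝ) (x : ℝ × ℝ) :
    Dcal p β s x = ∫ ξ : ℝ × ℝ, ((1 / Real.Gamma (β + 1) * truncPow p β s ξ : ℝ) : ℂ) *
      e2πi (x.1 * ξ.1 + x.2 * ξ.2) := by
  simp only [Dcal, pnorm_rpow hp, Complex.ofReal_mul, mul_assoc]
  rw [integral_const_mul, ← integral_indicator
    (measurableSet_lt (continuous_powSum hp).measurable measurable_const)]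
  congr 1
  refine integral_congr_ae (.of_forall fun ξ => ?_)
  simp only [Set.indicator_apply, truncPow, Set.mem_ofPred_eq]
  split_ifs <;> simp

lemma Dlat_eq {p : ℝ} (hp : 0 < p) (β s : ℝ) (x : ℝ × ℝ) :
    Dlat p β s x = ∑' m : ℤ × ℤ,
      ((1 / Real.Gamma (β + 1) * truncPow p β s (m.1, m.2) : ℝ) : ℂ) *
        e2πi (x.1 * m.1 + x.2 * m.2) := by
  simp only [Dlat, pnorm_rpow hp, Complex.ofReal_mul, mul_assoc]
  rw [tsum_mul_left]
  congr 1
  refine tsum_congr fun m => ?_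
  simp only [truncPow]
  split_ifs <;> simp

lemma Dcal_rpow_mul {p : ℝ} (hp : 0 < p) (β s : ℝ) {r : ℝ} (hr : 0 < r) (x : ℝ × ℝ) :
    Dcal p β (r ^ p * s) x = ((r ^ 2 * (r ^ p) ^ β : ℝ) : ℂ) * Dcal p β s (r • x) := by
  rw [Dcal_eq hp, Dcal_eq hp]
  have h := Measure.integral_comp_smul volume (fun ξ : ℝ × ℝ =>
    ((1 / Real.Gamma (β + 1) * truncPow p β (r ^ p * s) ξ : ℝ) : ℂ) *
      e2πi (x.1 * ξ.1 + x.2 * ξ.2)) r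
  have h2 : |(r ^ Module.finrank ℝ (ℝ × ℝ))⁻¹| = (r ^ 2)⁻¹ := by
    rw [Module.finrank_prod, Module.finrank_self, abs_of_pos (by positivity)]
  rw [h2, eq_inv_smul_iff₀ (by positivity)] at h
  rw [← h, ← integral_smul, ← integral_const_mul]
  refine integral_congr_ae (.of_forall fun ξ => ?_)
  simp only [truncPow_smul p β s hr, Prod.smul_fst, Prod.smul_snd, smul_eq_mul, Complex.real_smul]
  have h3 : x.1 * (r * ξ.1) + x.2 * (r * ξ.2) = r * x.1 * ξ.1 + r * x.2 * ξ.2 := by ring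
  rw [h3]
  push_cast
  ring

lemma integrable_Dcal {p β s : ℝ} (hp : 0 < p) (hs : 0 < s)
    (hint : Integrable fun x : ℝ × ℝ => Dcal p β 1 x) :
    Integrable fun x : ℝ × ℝ => Dcal p β s x := by
  have hr : 0 < s ^ p⁻¹ := by positivity
  have hrp : (s ^ p⁻¹) ^ p * 1 = s := by rw [Real.rpow_inv_rpow hs.le hp.ne', mul_one]
  rw [← hrp]
  simp only [Dcal_rpow_mul hp β 1 hr]
  exact (hint.comp_smul hr.ne').const_mul _

lemma truncPow_eq_integral_Dcal {p β s : ℝ} (hp : 0 < p) (hβ : -1 < β) (hs : 0 < s)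
    (hint : Integrable fun x : ℝ × ℝ => Dcal p β s x) {η : ℝ × ℝ}
    (hη : ContinuousAt (truncPow p β s) η) :
    ((1 / Real.Gamma (β + 1) * truncPow p β s η : ℝ) : ℂ) =
      ∫ z : ℝ × ℝ, Dcal p β s z * e2πi (-(z.1 * η.1 + z.2 * η.2)) := by
  simp only [Dcal_eq hp] at hint ⊢
  refine (integral_fourier_mul_e2πi_neg
    (f := fun ξ => ((1 / Real.Gamma (β + 1) * truncPow p β s ξ : ℝ) : ℂ)) ?_ hint ?_).symm
  · exact ((integrable_truncPow hp hβ hs).const_mul _).ofReal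
  · exact Complex.continuous_ofReal.continuousAt.comp (hη.const_mul _)

lemma continuous_truncPow {p β : ℝ} (hp : 0 < p) (hβ : 0 < β) (s : ℝ) :
    Continuous (truncPow p β s) := by
  have : truncPow p β s = fun ξ => (max (s - powSum p ξ) 0) ^ β := by
    ext ξ
    unfold truncPow
    split_ifs with h
    · rw [max_eq_left (by linarith)]
    · rw [max_eq_right (by linarith), Real.zero_rpow hβ.ne']
  rw [this]
  exact ((continuous_const.sub (continuous_powSum hp)).max continuous_const).rpow_const
    fun _ => .inr hβ.le

lemma continuousAt_truncPow {p s : ℝ} (hp : 0 < p) (β : ℝ) {η : ℝ × ℝ} (h : powSum p η ≠ s) :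
    ContinuousAt (truncPow p β s) η := by
  have hc := (continuous_powSum hp).continuousAt (x := η)
  rcases h.lt_or_gt with h | h
  · have h1 : ContinuousAt (fun ξ => (s - powSum p ξ) ^ β) η :=
      (continuousAt_const.sub hc).rpow_const (.inl (sub_pos.mpr h).ne')
    refine h1.congr ?_
    filter_upwards [hc.eventually_lt continuousAt_const h] with ξ hξ
    rw [truncPow, if_pos hξ]
  · refine (continuousAt_const (y := (0 : ℝ))).congr ?_
    filter_upwards [continuousAt_const.eventually_lt hc h] with ξ hξ
    rw [truncPow, if_neg hξ.not_gt]

/-- Integrability of the Fourier transform forces continuity of the truncated power. -/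
lemma pos_of_integrable_Dcal {p β : ℝ} (hp : 0 < p) (hβ : -1 < β)
    (hint : Integrable fun x : ℝ × ℝ => Dcal p β 1 x) : 0 < β := by
  by_contra! hβ0
  have hΓ : 0 < 1 / Real.Gamma (β + 1) := one_div_pos.mpr (Real.Gamma_pos_of_pos (by linarith))
  have hpow : ∀ t : ℝ, 0 < t → powSum p (t, 0) = t ^ p := fun t ht => by
    simp [powSum, abs_of_pos ht, Real.zero_rpow hp.ne']
  obtain ⟨h, hc, hval⟩ : ∃ h : ℝ → ℂ, Continuous h ∧ ∀ t : ℝ, 0 < t → t ^ p ≠ 1 →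
      h t = ((1 / Real.Gamma (β + 1) * truncPow p β 1 (t, 0) : ℝ) : ℂ) :=
    ⟨_, (continuous_integral_mul_e2πi_neg hint).comp (Continuous.prodMk_left (0 : ℝ)),
      fun t ht ht1 => (truncPow_eq_integral_Dcal hp hβ one_pos hint
        (continuousAt_truncPow hp β (by rwa [hpow t ht]))).symm⟩
  have hright : h 1 = 0 := by
    refine tendsto_nhds_unique_of_eventuallyEq (hc.continuousAt.mono_left nhdsWithin_le_nhds)
      (tendsto_const_nhds (f := nhdsWithin 1 (Set.Ioi 1))) ?_
    filter_upwards [self_mem_nhdsWithin] with t ht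
    have ht : 1 < t := ht
    have h1 := Real.one_lt_rpow ht hp
    rw [hval t (by linarith) h1.ne', truncPow, hpow t (by linarith), if_neg h1.not_gt]
    simp
  have hleft : 1 / Real.Gamma (β + 1) ≤ ‖h 1‖ := by
    refine ge_of_tendsto (hc.norm.continuousAt.mono_left (nhdsWithin_le_nhds (s := Set.Iio 1))) ?_
    filter_upwards [Ioo_mem_nhdsLT (zero_lt_one' ℝ)] with t ht
    have h1 := Real.rpow_lt_one ht.1.le ht.2 hp
    have h0 := Real.rpow_pos_of_pos ht.1 p
    rw [hval t ht.1 h1.ne, truncPow, hpow t ht.1, if_pos h1, Complex.norm_real]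
    refine le_trans ?_ (le_abs_self _)
    exact le_mul_of_one_le_right hΓ.le
      (Real.one_le_rpow_of_pos_of_le_one_of_nonpos (by linarith) (by linarith) hβ0)
  rw [hright, norm_zero] at hleft
  linarith

/-- Periodization identity: the periodization of `𝒟_β^[p](s : ·)` equals `D_β^[p](s : ·)`. -/
theorem periodization_eq (p β : ℝ) (hp : 0 < p) (hβ : -1 < β)
    (hint : Integrable (fun x : ℝ × ℝ => Dcal p β 1 x)) :
    ∀ s : ℝ, 0 < s → ∀ x : ℝ × ℝ,
      x.1 ∈ Set.Ioc (-(1/2) : ℝ) (1/2) → x.2 ∈ Set.Ioc (-(1/2) : ℝ) (1/2) →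
      (∑' n : ℤ × ℤ, Dcal p β s (x.1 - ((n.1 : ℝ)), x.2 - ((n.2 : ℝ)))) = Dlat p β s x := by
  intro s hs x _ _
  have hβ0 := pos_of_integrable_Dcal hp hβ hint
  have hints := integrable_Dcal hp hs hint
  rw [Dlat_eq hp]
  simp only [Dcal_eq hp]
  refine tsum_fourier_sub_eq_tsum (R := s ^ p⁻¹) hints
    (f := fun ξ => ((1 / Real.Gamma (β + 1) * truncPow p β s ξ : ℝ) : ℂ)) (fun ξ hξ => ?_)
    (fun ξ => truncPow_eq_integral_Dcal hp hβ hs hints (continuous_truncPow hp hβ0 s).continuousAt)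
    x
  refine abs_le_of_powSum_lt hp ?_
  contrapose! hξ
  rw [truncPow, if_neg hξ.not_gt]
  simp
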